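/- arXiv:2208.05108 — 10 statements merged into one kernel-verified Lean document; each statement's English description precedes it below -/
import Mathlib

section
/- Let 0 < α < 1 and A, B > 0. Then there exists a unique real number ρ₁ > 1 such that (A(ρ₁ − 1) + B(1 − ρ₁^{−α}))(ρ₁ − 1) = 2ρ₁. (This is the downstream shock density for the proceeding piston problem of the modified Chaplygin gas; it exists for every Mach number, in contrast to the pure and generalized Chaplygin gases.) -/
/-- The pressure jump across the shock is strictly increasing in the downstream density. -/
lemma mcg_pressure_jump_lt {α A B x y : ℝ} (hα : 0 < α) (hA : 0 < A) (hB : 0 < B)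
    (hx : 0 < x) (hxy : x < y) :
    A * (x - 1) + B * (1 - x ^ (-α)) < A * (y - 1) + B * (1 - y ^ (-α)) := by
  have hpow : y ^ (-α) < x ^ (-α) := Real.rpow_lt_rpow_of_neg hx hxy (neg_lt_zero.mpr hα)
  gcongr

/-- The shock relation cannot hold at two densities `x` and `y`
with `1 < x < y`. -/
lemma mcg_shock_not_lt {α A B x y : ℝ} (hα : 0 < α) (hA : 0 < A) (hB : 0 < B) (hx : 1 < x)
    (hxeq : (A * (x - 1) + B * (1 - x ^ (-α))) * (x - 1) = 2 * x)
    (hyeq : (A * (y - 1) + B * (1 - y ^ (-α))) * (y - 1) = 2 * y) :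
    ¬ x < y := by
  intro hxy
  have hF := mcg_pressure_jump_lt hα hA hB (by linarith) hxy
  generalize A * (x - 1) + B * (1 - x ^ (-α)) = p at *
  generalize A * (y - 1) + B * (1 - y ^ (-α)) = q at *
  have hpos : 0 < (x - 1) * (y - 1) := mul_pos (by linarith) (by linarith)
  have hmul := mul_lt_mul_of_pos_right hF hpos
  have h₁ : p * ((x - 1) * (y - 1)) = 2 * x * (y - 1) := by rw [← hxeq]; ring
  have h₂ : q * ((x - 1) * (y - 1)) = 2 * y * (x - 1) := by rw [← hyeq]; ring
  linarith

lemma mcg_shock_exists {α A B : ℝ} (hα : 0 < α) (hA : 0 < A) (hB : 0 < B) :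
    ∃ ρ : ℝ, 1 < ρ ∧ (A * (ρ - 1) + B * (1 - ρ ^ (-α))) * (ρ - 1) = 2 * ρ := by
  have ht : 0 < 4 / A := by positivity
  have hAt : A * (4 / A) = 4 := by field_simp
  generalize 4 / A = t at ht hAt
  have hcont : ContinuousOn
      (fun ρ : ℝ => (A * (ρ - 1) + B * (1 - ρ ^ (-α))) * (ρ - 1) - 2 * ρ)
      (Set.Icc 1 (2 + t)) := by
    have hpow : ContinuousOn (fun ρ : ℝ => ρ ^ (-α)) (Set.Icc 1 (2 + t)) :=
      continuousOn_id.rpow_const fun ρ hρ => Or.inl (zero_lt_one.trans_le hρ.1).ne'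
    fun_prop
  have hright : 0 ≤ (A * (2 + t - 1) + B * (1 - (2 + t) ^ (-α))) * (2 + t - 1)
      - 2 * (2 + t) := by
    have hpow : (2 + t) ^ (-α) ≤ 1 :=
      Real.rpow_le_one_of_one_le_of_nonpos (by linarith) (by linarith)
    have hBpow : 0 ≤ B * (1 - (2 + t) ^ (-α)) * (1 + t) :=
      mul_nonneg (mul_nonneg hB.le (by linarith)) (by linarith)
    have hApart : A * (1 + t) * (1 + t) = (A + 4) * (1 + t) := by
      linear_combination (1 + t) * hAt
    nlinarith [mul_pos hA ht]
  obtain ⟨ρ, hρ, hzero⟩ := intermediate_value_Icc (by linarith : (1 : ℝ) ≤ 2 + t) hcont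
    (show (0 : ℝ) ∈ Set.Icc _ _ from ⟨by norm_num, hright⟩)
  refine ⟨ρ, lt_of_le_of_ne hρ.1 ?_, sub_eq_zero.mp hzero⟩
  rintro rfl
  norm_num at hzero

/-- Existence and uniqueness of the downstream shock density `ρ₁ > 1` for the
proceeding piston problem of the modified Chaplygin gas `P(ρ) = Aρ - B/ρ^α`. -/
theorem mcg_proceeding_shock_density_exists_unique
    (α A B : ℝ) (hα0 : 0 < α) (hα1 : α < 1) (hA : 0 < A) (hB : 0 < B) :
    ∃! ρ₁ : ℝ, 1 < ρ₁ ∧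
      (A * (ρ₁ - 1) + B * (1 - ρ₁ ^ (-α))) * (ρ₁ - 1) = 2 * ρ₁ := by
  obtain ⟨ρ, hρ, heq⟩ := mcg_shock_exists hα0 hA hB
  refine ⟨ρ, ⟨hρ, heq⟩, fun σ ⟨hσ, hσeq⟩ => le_antisymm ?_ ?_⟩
  · exact not_lt.mp (mcg_shock_not_lt hα0 hA hB hρ heq hσeq)
  · exact not_lt.mp (mcg_shock_not_lt hα0 hA hB hσ hσeq heq)
end

section
/- Let 0 < α < 1 and A, B > 0, and let P(ρ) = Aρ − B/ρ^α. Then there exists a unique pair (ρ₁, σ) of real numbers with ρ₁ > 1 and σ < 0 such that σ(ρ₁ − 1) = −√2 and −√2·σ = P(ρ₁) − 2 − P(1). (These are the Rankine–Hugoniot conditions for a shock with speed σ connecting the upstream state (ρ, u) = (1, √2) to the downstream state (ρ₁, 0).) -/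
/-- The modified Chaplygin gas pressure is strictly increasing in the density. -/
theorem strictMonoOn_chaplyginPressure {α A B : ℝ} (hα : 0 < α) (hA : 0 < A) (hB : 0 < B) :
    StrictMonoOn (fun ρ : ℝ => A * ρ - B / ρ ^ α) (Set.Ioi 0) := by
  intro x hx y hy hxy
  have hx0 : (0 : ℝ) < x := hx
  have h1 : x ^ α < y ^ α := Real.rpow_lt_rpow hx0.le hxy hα
  have h2 : B / y ^ α < B / x ^ α :=
    div_lt_div_of_pos_left hB (Real.rpow_pos_of_pos hx0 α) h1
  have h3 : A * x < A * y := mul_lt_mul_of_pos_left hxy hA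
  dsimp only
  linarith

/-- Eliminating the shock speed from the Rankine–Hugoniot conditions leaves a scalar equation
for the downstream density, which has a solution. -/
theorem exists_downstream_density {α A B : ℝ} (hα : 0 < α) (hA : 0 < A) (hB : 0 < B) :
    ∃ ρ : ℝ, 1 < ρ ∧ (ρ - 1) * (A * ρ - B / ρ ^ α - 2 - (A - B)) = 2 := by
  have hM : 0 < 2 / A + 1 := by positivity
  have hcont : ContinuousOn (fun ρ : ℝ => (ρ - 1) * (A * ρ - B / ρ ^ α - 2 - (A - B)))
      (Set.Icc 1 (1 + (2 / A + 1))) := by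
    have hpow : ContinuousOn (fun ρ : ℝ => ρ ^ α) (Set.Icc 1 (1 + (2 / A + 1))) :=
      (Real.continuous_rpow_const hα.le).continuousOn
    have hdiv : ContinuousOn (fun ρ : ℝ => B / ρ ^ α) (Set.Icc 1 (1 + (2 / A + 1))) :=
      continuousOn_const.div hpow fun x hx =>
        (Real.rpow_pos_of_pos (lt_of_lt_of_le one_pos hx.1) α).ne'
    fun_prop
  have hright : 2 ≤ (1 + (2 / A + 1) - 1) *
      (A * (1 + (2 / A + 1)) - B / (1 + (2 / A + 1)) ^ α - 2 - (A - B)) := by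
    have hpow : 1 ≤ (1 + (2 / A + 1)) ^ α := Real.one_le_rpow (by linarith) hα.le
    have hdiv : B / (1 + (2 / A + 1)) ^ α ≤ B := div_le_self hB.le hpow
    have hAM : A * (2 / A + 1) = 2 + A := by field_simp
    calc (2 : ℝ) ≤ (2 / A + 1) * A := by linarith
      _ ≤ (2 / A + 1) * (A * (1 + (2 / A + 1)) - B / (1 + (2 / A + 1)) ^ α - 2 - (A - B)) :=
        mul_le_mul_of_nonneg_left (by linarith) hM.le
      _ = _ := by ring
  obtain ⟨ρ, hρ, heq⟩ := intermediate_value_Icc (by linarith) hcont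
    (show (2 : ℝ) ∈ Set.Icc _ _ from ⟨by simp, hright⟩)
  refine ⟨ρ, lt_of_le_of_ne hρ.1 ?_, heq⟩
  rintro rfl
  simp at heq

/-- There is a unique pair `(ρ₁, σ)` with `ρ₁ > 1`, `σ < 0` satisfying the
Rankine–Hugoniot conditions `σ(ρ₁ - 1) = -√2` and `-√2·σ = P(ρ₁) - 2 - P(1)`
for the modified Chaplygin gas `P(ρ) = Aρ - B/ρ^α`. -/
theorem mcg_shock_exists_unique
    (α A B : ℝ) (hα0 : 0 < α) (hα1 : α < 1) (hA : 0 < A) (hB : 0 < B)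
    (P : ℝ → ℝ) (hP : ∀ ρ : ℝ, 0 < ρ → P ρ = A * ρ - B / ρ ^ α) :
    ∃! p : ℝ × ℝ, 1 < p.1 ∧ p.2 < 0 ∧
      p.2 * (p.1 - 1) = -Real.sqrt 2 ∧
      -Real.sqrt 2 * p.2 = P p.1 - 2 - P 1 := by
  have hs : 0 < Real.sqrt 2 := by positivity
  have hss : Real.sqrt 2 * Real.sqrt 2 = 2 := Real.mul_self_sqrt (by norm_num)
  have hP1 : P 1 = A - B := by rw [hP 1 one_pos]; simp
  have hmono : ∀ x y : ℝ, 1 < x → x < y → P x < P y := by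
    intro x y hx hxy
    rw [hP x (by linarith), hP y (by linarith)]
    exact strictMonoOn_chaplyginPressure hα0 hA hB (Set.mem_Ioi.2 (by linarith))
      (Set.mem_Ioi.2 (by linarith)) hxy
  have hle : ∀ x s y t : ℝ, 1 < x → t < 0 → s * (x - 1) = -Real.sqrt 2 →
      -Real.sqrt 2 * s = P x - 2 - P 1 → t * (y - 1) = -Real.sqrt 2 →
      -Real.sqrt 2 * t = P y - 2 - P 1 → y ≤ x := by
    intro x s y t hx ht h1 h2 h3 h4
    by_contra! hxy
    have hPxy := hmono x y hx hxy
    have hts : t < s := by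
      by_contra! hst
      have := mul_le_mul_of_nonneg_left hst hs.le
      linarith
    have h5 : t * (x - 1) < s * (x - 1) := mul_lt_mul_of_pos_right hts (by linarith)
    have h6 : t * (y - 1) < t * (x - 1) := mul_lt_mul_of_neg_left (by linarith) ht
    linarith
  obtain ⟨ρ, hρ, heq⟩ := exists_downstream_density hα0 hA hB
  have hρ' : 0 < ρ - 1 := by linarith
  have hσ : -Real.sqrt 2 / (ρ - 1) < 0 := div_neg_of_neg_of_pos (by linarith) hρ'
  have hcont : -Real.sqrt 2 / (ρ - 1) * (ρ - 1) = -Real.sqrt 2 := div_mul_cancel₀ _ hρ'.ne'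
  have hmom : -Real.sqrt 2 * (-Real.sqrt 2 / (ρ - 1)) = P ρ - 2 - P 1 := by
    rw [hP1, hP ρ (by linarith), ← mul_div_assoc, neg_mul_neg, hss, div_eq_iff hρ'.ne', mul_comm,
      heq]
  refine ⟨(ρ, -Real.sqrt 2 / (ρ - 1)), ⟨hρ, hσ, hcont, hmom⟩, ?_⟩
  rintro ⟨y, t⟩ ⟨hy, ht, h1, h2⟩
  dsimp only at hy ht h1 h2
  have hyρ : y = ρ := le_antisymm (hle ρ _ y t hρ ht hcont hmom h1 h2)
    (hle y t ρ _ hy hσ h1 h2 hcont hmom)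
  subst hyρ
  exact Prod.ext rfl (eq_div_of_mul_eq hρ'.ne' h1)
end

section
/- Let 0 < α < 1 and A, B > 0, let P(ρ) = Aρ − B/ρ^α, and suppose ρ₁ > 1 satisfies P(ρ₁) = 2/(ρ₁ − 1) + 2 + P(1); set σ = −√2/(ρ₁ − 1). Define on Ω = {(t, x) : t > 0, x < 0} the piecewise constant functions (ρ, u)(t, x) = (1, √2) for x < σt and (ρ, u)(t, x) = (ρ₁, 0) for σt < x < 0. Then for every continuously differentiable, compactly supported test function φ : ℝ² → ℝ, the following two integral identities hold: ∫_Ω (ρ ∂_t φ + ρu ∂_x φ) dx dt + ∫_{−∞}^0 φ(0, x) dx = 0, and ∫_Ω (ρu ∂_t φ + (ρu² + P(ρ)) ∂_x φ) dx dt − ∫_0^∞ P(ρ₁) φ(t, 0) dt + ∫_{−∞}^0 √2 · φ(0, x) dx = 0. In other words, (ρ, u) is an integral weak solution of the proceeding piston problem. -/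
open MeasureTheory Set

section

variable {φ : ℝ × ℝ → ℝ}

theorem HasCompactSupport.comp_mk_left_affine {E : Type*} [Zero E] {f : ℝ × ℝ → E}
    (hf : HasCompactSupport f) (c d : ℝ) : HasCompactSupport fun t => f (t, c * t + d) := by
  refine hf.comp_isClosedEmbedding (g := fun t : ℝ => (t, c * t + d)) ?_
  exact Topology.IsClosedEmbedding.of_continuous_injective_isClosedMap (by fun_prop)
    (fun a b h => (Prod.ext_iff.1 h).1)
    (Function.LeftInverse.isClosedEmbedding (f := Prod.fst) (fun _ => rfl)
      (by fun_prop) (by fun_prop)).isClosedMap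

theorem HasCompactSupport.comp_mk_right {E : Type*} [Zero E] {f : ℝ × ℝ → E}
    (hf : HasCompactSupport f) (t : ℝ) : HasCompactSupport fun x => f (t, x) := by
  refine hf.comp_isClosedEmbedding (g := fun x : ℝ => (t, x)) ?_
  exact Function.LeftInverse.isClosedEmbedding (f := Prod.snd) (fun _ => rfl)
      (by fun_prop) (by fun_prop)

theorem ContDiff.continuous_fderiv_const (hφ : ContDiff ℝ 1 φ) (v : ℝ × ℝ) :
    Continuous fun p => fderiv ℝ φ p v :=
  (hφ.continuous_fderiv one_ne_zero).clm_apply continuous_const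

theorem ContDiff.deriv_mk_left (hφ : ContDiff ℝ 1 φ) (t x : ℝ) :
    deriv (fun s => φ (s, x)) t = fderiv ℝ φ (t, x) (1, 0) := by
  have h := (hφ.differentiable one_ne_zero (t, x)).hasFDerivAt.comp_hasDerivAt t
    ((hasDerivAt_id t).prodMk (hasDerivAt_const t x))
  exact h.deriv

theorem ContDiff.deriv_mk_right (hφ : ContDiff ℝ 1 φ) (t x : ℝ) :
    deriv (fun y => φ (t, y)) x = fderiv ℝ φ (t, x) (0, 1) := by
  have h := (hφ.differentiable one_ne_zero (t, x)).hasFDerivAt.comp_hasDerivAt x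
    ((hasDerivAt_const x t).prodMk (hasDerivAt_id x))
  exact h.deriv

theorem integral_Iic_fderiv_snd (hφ : ContDiff ℝ 1 φ) (hφc : HasCompactSupport φ) (t b : ℝ) :
    ∫ x in Iic b, fderiv ℝ φ (t, x) (0, 1) = φ (t, b) := by
  simp_rw [← hφ.deriv_mk_right]
  exact (hφc.comp_mk_right t).integral_Iic_deriv_eq (hφ.comp (by fun_prop)) b

theorem integral_Ioi_fderiv_fst (hφ : ContDiff ℝ 1 φ) (hφc : HasCompactSupport φ) (x b : ℝ) :
    ∫ t in Ioi b, fderiv ℝ φ (t, x) (1, 0) = -φ (b, x) := by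
  simp_rw [← hφ.deriv_mk_left]
  have hc : HasCompactSupport fun t => φ (t, x) := by
    simpa using hφc.comp_mk_left_affine 0 x
  exact hc.integral_Ioi_deriv_eq (hφ.comp (by fun_prop)) b

/-- Integral of the time derivative over the region between a line `x = σ t` and the boundary. -/
theorem integral_fderiv_fst_behind_shock (hφ : ContDiff ℝ 1 φ) (hφc : HasCompactSupport φ)
    {σ : ℝ} (hσ : σ < 0) :
    ∫ t in Ioi (0 : ℝ), ∫ x in Iio (0 : ℝ),
        {p : ℝ × ℝ | σ * p.1 < p.2}.indicator (fun p => fderiv ℝ φ p (1, 0)) (t, x)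
      = σ * ∫ t in Ioi (0 : ℝ), φ (t, σ * t) := by
  have hmeas : MeasurableSet {p : ℝ × ℝ | σ * p.1 < p.2} :=
    measurableSet_lt (by fun_prop) (by fun_prop)
  have hint : Integrable (fun p => fderiv ℝ φ p (1, 0)) :=
    (hφ.continuous_fderiv_const _).integrable_of_hasCompactSupport (hφc.fderiv_apply ℝ _)
  rw [integral_integral_swap]
  · have hx : ∀ x ∈ Iio (0 : ℝ), ∫ t in Ioi (0 : ℝ),
        {p : ℝ × ℝ | σ * p.1 < p.2}.indicator (fun p => fderiv ℝ φ p (1, 0)) (t, x)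
          = -φ (σ⁻¹ * x, x) := by
      intro x hx
      have hpos : 0 < σ⁻¹ * x := mul_pos_of_neg_of_neg (inv_lt_zero.2 hσ) hx
      have : (fun t => {p : ℝ × ℝ | σ * p.1 < p.2}.indicator
          (fun p => fderiv ℝ φ p (1, 0)) (t, x))
          = (Ioi (σ⁻¹ * x)).indicator fun t => fderiv ℝ φ (t, x) (1, 0) := by
        ext t
        have : σ * t < x ↔ σ⁻¹ * x < t := by
          rw [inv_mul_eq_div, div_lt_iff_of_neg hσ, mul_comm t]
        simp [indicator, this]
      rw [this, setIntegral_indicator measurableSet_Ioi, Ioi_inter_Ioi, max_eq_right hpos.le,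
        integral_Ioi_fderiv_fst hφ hφc]
    rw [setIntegral_congr_fun measurableSet_Iio hx, integral_neg]
    have h1 := integral_comp_mul_left_Ioi (fun y => φ (-σ⁻¹ * y, -y)) 0 (neg_pos.2 hσ)
    have h2 := integral_comp_neg_Ioi 0 (fun x => φ (σ⁻¹ * x, x))
    have h3 : ∀ t, φ (-σ⁻¹ * (-σ * t), -(-σ * t)) = φ (t, σ * t) := by
      intro t
      congr 2
      · rw [neg_mul σ, neg_mul_neg, inv_mul_cancel_left₀ hσ.ne]
      · ring
    simp only [h3, mul_zero, smul_eq_mul] at h1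
    rw [neg_zero, integral_Iic_eq_integral_Iio] at h2
    rw [h1, ← h2, ← mul_assoc, inv_neg, mul_neg, mul_inv_cancel₀ hσ.ne, neg_one_mul]
    simp only [mul_neg, neg_mul]
  · rw [Measure.prod_restrict]
    exact (hint.indicator hmeas).integrableOn

theorem integral_add_sub_add {X : Type*} [MeasurableSpace X] {μ : Measure X} {f g h k : X → ℝ}
    (hf : Integrable f μ) (hg : Integrable g μ) (hh : Integrable h μ) (hk : Integrable k μ) :
    ∫ x, (f x + g x - h x + k x) ∂μ
      = (∫ x, f x ∂μ) + (∫ x, g x ∂μ) - (∫ x, h x ∂μ) + ∫ x, k x ∂μ := by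
  have hfg : Integrable (fun x => f x + g x) μ := hf.add hg
  have hfgh : Integrable (fun x => f x + g x - h x) μ := hfg.sub hh
  rw [integral_add hfgh hk, integral_sub hfg hh, integral_add hf hg]

/-- A function that is piecewise constant across the line `x = σ t` and satisfies the
Rankine–Hugoniot condition is a weak solution of the scalar balance law. -/
theorem integral_piecewise_const_flux (hφ : ContDiff ℝ 1 φ) (hφc : HasCompactSupport φ)
    {σ a₁ a₂ b₁ b₂ : ℝ} (hσ : σ < 0) (hRH : b₂ - b₁ = σ * (a₂ - a₁)) {a b : ℝ → ℝ → ℝ}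
    (hup : ∀ t x, 0 < t → x < σ * t → a t x = a₁ ∧ b t x = b₁)
    (hdown : ∀ t x, 0 < t → σ * t < x → x < 0 → a t x = a₂ ∧ b t x = b₂) :
    ∫ t in Ioi (0 : ℝ), ∫ x in Iio (0 : ℝ),
        (a t x * fderiv ℝ φ (t, x) (1, 0) + b t x * fderiv ℝ φ (t, x) (0, 1))
      = b₂ * (∫ t in Ioi (0 : ℝ), φ (t, 0)) - a₁ * ∫ x in Iio (0 : ℝ), φ (0, x) := by
  set S : Set (ℝ × ℝ) := {p | σ * p.1 < p.2}
  have hmeas : MeasurableSet S := measurableSet_lt (by fun_prop) (by fun_prop)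
  have hint : Integrable (fun p => fderiv ℝ φ p (1, 0)) :=
    (hφ.continuous_fderiv_const _).integrable_of_hasCompactSupport (hφc.fderiv_apply ℝ _)
  have hslice : ∀ v t, Integrable fun x => fderiv ℝ φ (t, x) v := fun v t =>
    ((hφ.continuous_fderiv_const v).comp (by fun_prop)).integrable_of_hasCompactSupport
      ((hφc.fderiv_apply ℝ v).comp_mk_right t)
  have hline : ∀ c, Integrable fun t => φ (t, c * t) := fun c =>
    (hφ.continuous.comp' (by fun_prop)).integrable_of_hasCompactSupport
      (by simpa using hφc.comp_mk_left_affine c 0)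
  have hprod : Integrable (fun p => fderiv ℝ φ p (1, 0))
      ((volume.restrict (Ioi (0 : ℝ))).prod (volume.restrict (Iio (0 : ℝ)))) := by
    rw [Measure.prod_restrict]
    exact hint.integrableOn
  have hinner : ∀ t ∈ Ioi (0 : ℝ), ∫ x in Iio (0 : ℝ),
      (a t x * fderiv ℝ φ (t, x) (1, 0) + b t x * fderiv ℝ φ (t, x) (0, 1))
      = a₁ * (∫ x in Iio (0 : ℝ), fderiv ℝ φ (t, x) (1, 0)) + b₂ * φ (t, 0)
        - (b₂ - b₁) * φ (t, σ * t)
        + (a₂ - a₁) * ∫ x in Iio (0 : ℝ), S.indicator (fun p => fderiv ℝ φ p (1, 0)) (t, x) := by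
    intro t ht
    have hst : σ * t < 0 := mul_neg_of_neg_of_pos hσ ht
    have hind : ∀ x, S.indicator (fun p => fderiv ℝ φ p (1, 0)) (t, x)
        = (Ioi (σ * t)).indicator (fun x => fderiv ℝ φ (t, x) (1, 0)) x := fun x => by
      simp [indicator, S]
    have hae : ∀ᵐ x ∂volume.restrict (Iio (0 : ℝ)),
        a t x * fderiv ℝ φ (t, x) (1, 0) + b t x * fderiv ℝ φ (t, x) (0, 1)
        = a₁ * fderiv ℝ φ (t, x) (1, 0) + b₂ * fderiv ℝ φ (t, x) (0, 1)
          - (b₂ - b₁) * (Iic (σ * t)).indicator (fun x => fderiv ℝ φ (t, x) (0, 1)) x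
          + (a₂ - a₁) * (Ioi (σ * t)).indicator (fun x => fderiv ℝ φ (t, x) (1, 0)) x := by
      filter_upwards [ae_restrict_mem measurableSet_Iio,
        ae_restrict_of_ae (Measure.ae_ne volume (σ * t))] with x hx hne
      rcases lt_or_gt_of_ne hne with h | h
      · obtain ⟨ha, hb⟩ := hup t x ht h
        rw [ha, hb, indicator_of_mem (mem_Iic.2 h.le), indicator_of_notMem (by simpa using h.le)]
        ring
      · obtain ⟨ha, hb⟩ := hdown t x ht h hx
        rw [ha, hb, indicator_of_notMem (by simpa using h), indicator_of_mem (mem_Ioi.2 h)]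
        ring
    have i₁ := ((hslice (1, 0) t).restrict (s := Iio 0)).const_mul a₁
    have i₂ := ((hslice (0, 1) t).restrict (s := Iio 0)).const_mul b₂
    have i₃ := (((hslice (0, 1) t).indicator (measurableSet_Iic (a := σ * t))).restrict
      (s := Iio 0)).const_mul (b₂ - b₁)
    have i₄ := (((hslice (1, 0) t).indicator (measurableSet_Ioi (a := σ * t))).restrict
      (s := Iio 0)).const_mul (a₂ - a₁)
    rw [integral_congr_ae hae, integral_add_sub_add i₁ i₂ i₃ i₄]
    simp_rw [hind, integral_const_mul]
    rw [setIntegral_indicator measurableSet_Iic,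
      inter_eq_right.2 (Iic_subset_Iio.2 hst), integral_Iic_fderiv_snd hφ hφc,
      ← integral_Iic_eq_integral_Iio (f := fun x => fderiv ℝ φ (t, x) (0, 1)),
      integral_Iic_fderiv_snd hφ hφc]
  have j₁ := hprod.integral_prod_left.const_mul a₁
  have j₂ := ((hline 0).restrict (s := Ioi 0)).const_mul b₂
  have j₃ := ((hline σ).restrict (s := Ioi 0)).const_mul (b₂ - b₁)
  have j₄ := (hprod.indicator hmeas).integral_prod_left.const_mul (a₂ - a₁)
  simp only [zero_mul] at j₂
  have hswap : ∫ t in Ioi (0 : ℝ), ∫ x in Iio (0 : ℝ), fderiv ℝ φ (t, x) (1, 0)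
      = -∫ x in Iio (0 : ℝ), φ (0, x) := by
    rw [integral_integral_swap hprod]
    simp_rw [integral_Ioi_fderiv_fst hφ hφc, integral_neg]
  rw [setIntegral_congr_fun measurableSet_Ioi hinner, integral_add_sub_add j₁ j₂ j₃ j₄]
  simp_rw [integral_const_mul]
  rw [hswap, integral_fderiv_fst_behind_shock hφ hφc hσ, hRH]
  ring

end


/-- The piecewise constant shock solution is an integral weak solution of the
proceeding piston problem for the modified Chaplygin gas. -/
theorem mcg_shock_is_integral_weak_solution
    (α A B : ℝ) (hα0 : 0 < α) (hα1 : α < 1) (hA : 0 < A) (hB : 0 < B)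
    (ρ₁ : ℝ) (hρ₁ : 1 < ρ₁)
    (hRH : A * ρ₁ - B / ρ₁ ^ α = 2 / (ρ₁ - 1) + 2 + (A * 1 - B / (1:ℝ) ^ α))
    (σ : ℝ) (hσ : σ = -Real.sqrt 2 / (ρ₁ - 1))
    (ρ u : ℝ → ℝ → ℝ)
    (hupstream : ∀ t x : ℝ, 0 < t → x < σ * t → ρ t x = 1 ∧ u t x = Real.sqrt 2)
    (hdownstream : ∀ t x : ℝ, 0 < t → σ * t < x → x < 0 → ρ t x = ρ₁ ∧ u t x = 0)
    (φ : ℝ × ℝ → ℝ) (hφ : ContDiff ℝ 1 φ) (hφc : HasCompactSupport φ) :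
    ((∫ t in Set.Ioi (0:ℝ), ∫ x in Set.Iio (0:ℝ),
        (ρ t x * fderiv ℝ φ (t, x) (1, 0) + ρ t x * u t x * fderiv ℝ φ (t, x) (0, 1)))
      + ∫ x in Set.Iio (0:ℝ), φ (0, x)) = 0 ∧
    ((∫ t in Set.Ioi (0:ℝ), ∫ x in Set.Iio (0:ℝ),
        (ρ t x * u t x * fderiv ℝ φ (t, x) (1, 0)
          + (ρ t x * u t x ^ 2 + (A * ρ t x - B / ρ t x ^ α)) * fderiv ℝ φ (t, x) (0, 1)))
      - (∫ t in Set.Ioi (0:ℝ), (A * ρ₁ - B / ρ₁ ^ α) * φ (t, 0))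
      + ∫ x in Set.Iio (0:ℝ), Real.sqrt 2 * φ (0, x)) = 0 := by
  have hpos : 0 < ρ₁ - 1 := sub_pos.2 hρ₁
  have hsq : Real.sqrt 2 * Real.sqrt 2 = 2 := Real.mul_self_sqrt (by norm_num)
  have hσ0 : σ < 0 := by
    rw [hσ]
    exact div_neg_of_neg_of_pos (neg_neg_of_pos (by positivity)) hpos
  constructor
  · rw [integral_piecewise_const_flux hφ hφc (a₁ := 1) (a₂ := ρ₁) (b₁ := Real.sqrt 2) (b₂ := 0)
      (a := ρ) (b := fun t x => ρ t x * u t x) hσ0]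
    · ring
    · rw [hσ]
      field_simp
      ring
    · intro t x ht hx
      obtain ⟨h₁, h₂⟩ := hupstream t x ht hx
      simp [h₁, h₂]
    · intro t x ht hx hx0
      obtain ⟨h₁, h₂⟩ := hdownstream t x ht hx hx0
      simp [h₁, h₂]
  · rw [integral_piecewise_const_flux hφ hφc (a₁ := Real.sqrt 2) (a₂ := 0)
      (b₁ := 2 + (A * 1 - B / (1 : ℝ) ^ α)) (b₂ := A * ρ₁ - B / ρ₁ ^ α)
      (a := fun t x => ρ t x * u t x)
      (b := fun t x => ρ t x * u t x ^ 2 + (A * ρ t x - B / ρ t x ^ α)) hσ0]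
    · rw [integral_const_mul, integral_const_mul]
      ring
    · rw [hRH, hσ, Real.one_rpow]
      field_simp
      linear_combination -hsq
    · intro t x ht hx
      obtain ⟨h₁, h₂⟩ := hupstream t x ht hx
      simp [h₁, h₂]
    · intro t x ht hx hx0
      obtain ⟨h₁, h₂⟩ := hdownstream t x ht hx hx0
      simp [h₁, h₂]
end

section
/- Let 0 < α < 1 and A, B > 0, and for ρ > 0 set N(ρ) = √(A + Bα·ρ^{−(α+1)}). Then the function G(ρ) = (2/(α+1))·N(ρ) − (√A/(α+1))·ln(2√A·ρ^{α+1}·(N(ρ) + √A) + Bα) is differentiable at every ρ > 0 with derivative G′(ρ) = −N(ρ)/ρ. (G is the Riemann-invariant antiderivative used to parametrize the rarefaction curves of the modified Chaplygin Euler system, since N(ρ) is the local sound speed.) -/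
/-- The argument of the logarithm is `ρ^k (N + √A)²`, so its logarithm splits. -/
theorem log_riemann_invariant_arg {A C k ρ : ℝ} (hA : 0 < A) (hC : 0 ≤ C) (hρ : 0 < ρ) :
    Real.log (2 * √A * ρ ^ k * (√(A + C * ρ ^ (-k)) + √A) + C) =
      k * Real.log ρ + 2 * Real.log (√(A + C * ρ ^ (-k)) + √A) := by
  have hx : 0 < ρ ^ k := Real.rpow_pos_of_pos hρ k
  have hs : 0 < √A := Real.sqrt_pos.2 hA
  have hsum : 0 < √(A + C * ρ ^ (-k)) + √A := by positivity
  have hN : √(A + C * ρ ^ (-k)) ^ 2 = A + C * ρ ^ (-k) := Real.sq_sqrt (by positivity)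
  have hinv : ρ ^ k * ρ ^ (-k) = 1 := by
    rw [Real.rpow_neg hρ.le, mul_inv_cancel₀ hx.ne']
  have harg : 2 * √A * ρ ^ k * (√(A + C * ρ ^ (-k)) + √A) + C =
      ρ ^ k * (√(A + C * ρ ^ (-k)) + √A) ^ 2 := by
    linear_combination -ρ ^ k * hN + ρ ^ k * Real.sq_sqrt hA.le - C * hinv
  rw [harg, Real.log_mul hx.ne' (pow_pos hsum 2).ne', Real.log_rpow hρ, Real.log_pow]
  norm_num

/-- The derivative of the sound speed `N`, in the form `N' = -k (N² - A) / (2ρN)`. -/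
theorem hasDerivAt_sqrt_add_mul_rpow_neg {A C k ρ : ℝ} (hA : 0 < A) (hC : 0 ≤ C) (hρ : 0 < ρ) :
    HasDerivAt (fun r : ℝ => √(A + C * r ^ (-k)))
      (-k * (√(A + C * ρ ^ (-k)) ^ 2 - A) / (2 * ρ * √(A + C * ρ ^ (-k)))) ρ := by
  have hpos : 0 < A + C * ρ ^ (-k) := by positivity
  have hN : 0 < √(A + C * ρ ^ (-k)) := Real.sqrt_pos.2 hpos
  have h := (((Real.hasDerivAt_rpow_const (p := -k) (Or.inl hρ.ne')).const_mul C).const_add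
    A).sqrt hpos.ne'
  convert h using 1
  rw [Real.sq_sqrt hpos.le, Real.rpow_sub_one hρ.ne']
  field_simp
  ring

/-- The Riemann-invariant antiderivative
`G(ρ) = (2/(α+1))N(ρ) - (√A/(α+1))ln(2√A·ρ^{α+1}(N(ρ)+√A) + Bα)` satisfies
`G'(ρ) = -N(ρ)/ρ` for every `ρ > 0`, where `N(ρ) = √(A + Bα·ρ^{-(α+1)})`
is the local sound speed of the modified Chaplygin gas. -/
theorem mcg_riemann_invariant_deriv
    (α A B : ℝ) (hα0 : 0 < α) (hα1 : α < 1) (hA : 0 < A) (hB : 0 < B)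
    (N : ℝ → ℝ) (hN : ∀ ρ : ℝ, 0 < ρ → N ρ = Real.sqrt (A + B * α * ρ ^ (-(α + 1)))) :
    ∀ ρ : ℝ, 0 < ρ →
      HasDerivAt (fun ρ : ℝ =>
        (2 / (α + 1)) * Real.sqrt (A + B * α * ρ ^ (-(α + 1)))
          - (Real.sqrt A / (α + 1)) *
            Real.log (2 * Real.sqrt A * ρ ^ (α + 1) *
              (Real.sqrt (A + B * α * ρ ^ (-(α + 1))) + Real.sqrt A) + B * α))
        (-(N ρ) / ρ) ρ := by
  intro ρ hρ
  rw [hN ρ hρ]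
  have hC : 0 ≤ B * α := by positivity
  have hk : α + 1 ≠ 0 := by positivity
  have hs : 0 < √A := Real.sqrt_pos.2 hA
  have hNpos : 0 < √(A + B * α * ρ ^ (-(α + 1))) := Real.sqrt_pos.2 (by positivity)
  have hNderiv := hasDerivAt_sqrt_add_mul_rpow_neg (k := α + 1) hA hC hρ
  have hlog := ((Real.hasDerivAt_log hρ.ne').const_mul (α + 1)).add
    (((hNderiv.add_const √A).log (by positivity)).const_mul 2)
  have hG := (hNderiv.const_mul (2 / (α + 1))).sub (hlog.const_mul (√A / (α + 1)))
  refine (hG.congr_deriv ?_).congr_of_eventuallyEq ?_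
  · have hsq : A = √A ^ 2 := (Real.sq_sqrt hA.le).symm
    generalize √(A + B * α * ρ ^ (-(α + 1))) = n at hNpos ⊢
    generalize √A = s at hs hsq ⊢
    subst hsq
    have hns : n + s ≠ 0 := by positivity
    field_simp
    ring
  · filter_upwards [lt_mem_nhds hρ] with r hr
    simp only [log_riemann_invariant_arg hA hC hr, Pi.sub_apply, Pi.add_apply]
end

section
/- Let 0 < α < 1 and A, B > 0, and for ρ > 0 set N(ρ) = √(A + Bα·ρ^{−(α+1)}). Then the function H(ρ) = ((α − 1)/(α + 1))·N(ρ) + (√A/(α + 1))·(ln(Bα) + ln((N(ρ) + √A)/(N(ρ) − √A))) is strictly increasing on (0, ∞). (Consequently the density ρ(η) along the first-family rarefaction wave, determined implicitly by η + H(ρ) = W₀ for a constant W₀, is a strictly decreasing function of the self-similar variable η = x/t.) -/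
/-- The local sound speed of the modified Chaplygin gas is strictly decreasing in the density. -/
theorem strictAntiOn_sqrt_add_mul_rpow_neg {a c p : ℝ} (ha : 0 ≤ a) (hc : 0 < c) (hp : 0 < p) :
    StrictAntiOn (fun ρ : ℝ => Real.sqrt (a + c * ρ ^ (-p))) (Set.Ioi 0) := by
  intro x hx y hy hxy
  have hy0 : (0 : ℝ) < y := hy
  have hpow : y ^ (-p) < x ^ (-p) := Real.rpow_lt_rpow_of_neg hx hxy (neg_neg_of_pos hp)
  refine Real.sqrt_lt_sqrt (by positivity) ?_
  gcongr

/-- For `s > 0` the function `n ↦ log ((n + s) / (n - s))` is strictly decreasing on `(s, ∞)`. -/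
theorem strictAntiOn_log_add_div_sub {s : ℝ} (hs : 0 < s) :
    StrictAntiOn (fun n : ℝ => Real.log ((n + s) / (n - s))) (Set.Ioi s) := by
  intro m hm n hn hmn
  have hm' : 0 < m - s := sub_pos.2 hm
  have hn' : 0 < n - s := sub_pos.2 hn
  refine Real.log_lt_log (div_pos (by linarith) hn') ?_
  rw [div_lt_div_iff₀ hn' hm']
  nlinarith [mul_pos hs (sub_pos.2 hmn)]

/-- The function
`H(ρ) = ((α-1)/(α+1))N(ρ) + (√A/(α+1))(ln(Bα) + ln((N(ρ)+√A)/(N(ρ)-√A)))`,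
with `N(ρ) = √(A + Bα·ρ^{-(α+1)})`, is strictly increasing on `(0, ∞)`. -/
theorem mcg_first_rarefaction_monotone
    (α A B : ℝ) (hα0 : 0 < α) (hα1 : α < 1) (hA : 0 < A) (hB : 0 < B) :
    StrictMonoOn (fun ρ : ℝ =>
      ((α - 1) / (α + 1)) * Real.sqrt (A + B * α * ρ ^ (-(α + 1)))
        + (Real.sqrt A / (α + 1)) * (Real.log (B * α)
          + Real.log ((Real.sqrt (A + B * α * ρ ^ (-(α + 1))) + Real.sqrt A) /
              (Real.sqrt (A + B * α * ρ ^ (-(α + 1))) - Real.sqrt A))))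
      (Set.Ioi 0) := by
  intro x hx y hy hxy
  have hc : 0 < B * α := mul_pos hB hα0
  have hp : 0 < α + 1 := by linarith
  have sqrt_lt {ρ : ℝ} (hρ : ρ ∈ Set.Ioi (0 : ℝ)) :
      Real.sqrt A < Real.sqrt (A + B * α * ρ ^ (-(α + 1))) :=
    Real.sqrt_lt_sqrt hA.le
      (lt_add_of_pos_right A (mul_pos hc (Real.rpow_pos_of_pos hρ _)))
  have hN := strictAntiOn_sqrt_add_mul_rpow_neg hA.le hc hp hx hy hxy
  have hlog := strictAntiOn_log_add_div_sub (Real.sqrt_pos.2 hA) (sqrt_lt hy) (sqrt_lt hx) hN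
  exact add_lt_add
    (mul_lt_mul_of_neg_left hN (div_neg_of_neg_of_pos (by linarith) hp))
    (mul_lt_mul_of_pos_left (add_lt_add_right hlog _) (div_pos (Real.sqrt_pos.2 hA) hp))
end

section
/- Let C > 0. Then there exists a unique real number Q₀ < 0 such that C·exp(−2Q₀)·(Q₀ + 1) = Q₀ − 1, and moreover this Q₀ satisfies Q₀ < −1. -/
/-- A negative solution of `C·exp(-2Q)(Q+1) = Q - 1` with `C > 0` lies below `-1`. -/
lemma lt_neg_one_of_slope_eq {C Q : ℝ} (hC : 0 < C) (hQ : Q < 0)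
    (h : C * Real.exp (-2 * Q) * (Q + 1) = Q - 1) : Q < -1 := by
  by_contra! hle
  have : 0 ≤ C * Real.exp (-2 * Q) * (Q + 1) := mul_nonneg (by positivity) (by linarith)
  linarith

/-- There are no two distinct ordered solutions of `C·exp(-2Q)(Q+1) = Q - 1` below `-1`. -/
lemma not_lt_of_slope_eq {C a b : ℝ} (hC : 0 < C) (hb : b < -1)
    (ha' : C * Real.exp (-2 * a) * (a + 1) = a - 1)
    (hb' : C * Real.exp (-2 * b) * (b + 1) = b - 1) : ¬ a < b := by
  intro hab
  have hexp : C * Real.exp (-2 * b) < C * Real.exp (-2 * a) :=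
    mul_lt_mul_of_pos_left (Real.exp_lt_exp.2 (by linarith)) hC
  have hpos : 0 < (a + 1) * (b + 1) := mul_pos_of_neg_of_neg (by linarith) (by linarith)
  have key : (b - 1) * (a + 1) < (a - 1) * (b + 1) := by
    rw [← ha', ← hb']
    linarith [mul_lt_mul_of_pos_right hexp hpos]
  linarith

/-- For `C > 0` the equation `C·exp(-2Q)(Q+1) = Q - 1` has a negative solution. -/
lemma exists_slope_eq {C : ℝ} (hC : 0 < C) :
    ∃ Q : ℝ, Q < 0 ∧ C * Real.exp (-2 * Q) * (Q + 1) = Q - 1 := by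
  have hinv : 0 < C⁻¹ := inv_pos.2 hC
  have hcont : ContinuousOn (fun Q : ℝ => C * Real.exp (-2 * Q) * (Q + 1) - (Q - 1))
      (Set.Icc (-(2 + C⁻¹)) (-1)) := by fun_prop
  have hleft : C * Real.exp (-2 * -(2 + C⁻¹)) * (-(2 + C⁻¹) + 1) - (-(2 + C⁻¹) - 1) ≤ 0 := by
    have hmul : C * (-(2 + C⁻¹) + 1) = -(C + 1) := by
      field_simp
      ring
    have hexp := Real.add_one_le_exp (-2 * -(2 + C⁻¹))
    rw [mul_right_comm, hmul]
    nlinarith [mul_pos hC (Real.exp_pos (-2 * -(2 + C⁻¹)))]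
  obtain ⟨Q, hQ, h⟩ := intermediate_value_Icc (by linarith) hcont
    (show (0 : ℝ) ∈ Set.Icc _ _ from ⟨hleft, by norm_num⟩)
  exact ⟨Q, by linarith [hQ.2], sub_eq_zero.1 h⟩


/-- For `C > 0` there exists a unique `Q₀ < 0` with
`C·exp(-2Q₀)(Q₀+1) = Q₀ - 1`, and moreover `Q₀ < -1`. -/
theorem receding_tail_slope_exists_unique
    (C : ℝ) (hC : 0 < C) :
    ∃ Q₀ : ℝ, Q₀ < 0 ∧ C * Real.exp (-2 * Q₀) * (Q₀ + 1) = Q₀ - 1 ∧ Q₀ < -1 ∧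
      ∀ Q : ℝ, Q < 0 → C * Real.exp (-2 * Q) * (Q + 1) = Q - 1 → Q = Q₀ := by
  obtain ⟨Q₀, hneg, h₀⟩ := exists_slope_eq hC
  have hlt := lt_neg_one_of_slope_eq hC hneg h₀
  refine ⟨Q₀, hneg, h₀, hlt, fun Q hQ h => ?_⟩
  have hQlt := lt_neg_one_of_slope_eq hC hQ h
  exact le_antisymm (not_lt.1 (not_lt_of_slope_eq hC hQlt h₀ h))
    (not_lt.1 (not_lt_of_slope_eq hC hlt h h₀))
end

section
/- Let 0 < α < 1, M₀ > 0, and A, B > 0 satisfy (A + Bα)·M₀² = 2. Set C = exp((−√2(α+1) − 2√2/M₀)/√A) · (√2 + √A·M₀)/(√2 − √A·M₀) and Q̂ = −√2(1 + 1/M₀)/√A. Then √A·M₀ < √2 (so C > 0), Q̂ < −1, and exp(−2Q̂) − 1/C + 2/(C(Q̂ + 1)) > 0. -/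
/-- Under the normalization `(A + Bα)M₀² = 2`, with
`C = exp((-√2(α+1) - 2√2/M₀)/√A)·(√2 + √A·M₀)/(√2 - √A·M₀)` and
`Q̂ = -√2(1 + 1/M₀)/√A`, one has `√A·M₀ < √2` (so `C > 0`), `Q̂ < -1`, and
`F(Q̂) = exp(-2Q̂) - 1/C + 2/(C(Q̂+1)) > 0`. -/
theorem receding_head_value_positive
    (α A B M₀ : ℝ) (hα0 : 0 < α) (hα1 : α < 1) (hA : 0 < A) (hB : 0 < B)
    (hM : 0 < M₀) (hnorm : (A + B * α) * M₀ ^ 2 = 2)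
    (C : ℝ)
    (hC : C = Real.exp ((-Real.sqrt 2 * (α + 1) - 2 * Real.sqrt 2 / M₀) / Real.sqrt A)
      * (Real.sqrt 2 + Real.sqrt A * M₀) / (Real.sqrt 2 - Real.sqrt A * M₀))
    (Qhat : ℝ) (hQhat : Qhat = -Real.sqrt 2 * (1 + 1 / M₀) / Real.sqrt A) :
    Real.sqrt A * M₀ < Real.sqrt 2 ∧ 0 < C ∧ Qhat < -1 ∧
      0 < Real.exp (-2 * Qhat) - 1 / C + 2 / (C * (Qhat + 1)) := by
  have hs : 0 < Real.sqrt 2 := by positivity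
  have ha : 0 < Real.sqrt A := Real.sqrt_pos.mpr hA
  have hlt : Real.sqrt A * M₀ < Real.sqrt 2 := by
    apply lt_of_pow_lt_pow_left₀ 2 hs.le
    rw [mul_pow, Real.sq_sqrt hA.le, Real.sq_sqrt zero_le_two]
    have : 0 < B * α * M₀ ^ 2 := by positivity
    linarith
  generalize Real.sqrt 2 = s at *
  generalize Real.sqrt A = a at *
  have hd : 0 < s - a * M₀ := sub_pos.mpr hlt
  have hn : 0 < s + a * M₀ := by positivity
  have hsM : 0 < s * M₀ := by positivity
  have hden : 0 < s * M₀ + (s - a * M₀) := by positivity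
  have hCpos : 0 < C := by rw [hC]; positivity
  have hQ : Qhat + 1 = -((s * M₀ + (s - a * M₀)) / (a * M₀)) := by
    rw [hQhat]; field_simp; ring
  have hQlt : Qhat < -1 := by
    have : 0 < (s * M₀ + (s - a * M₀)) / (a * M₀) := by positivity
    linarith
  refine ⟨hlt, hCpos, hQlt, ?_⟩
  have hexp : (s + a * M₀) / (s - a * M₀) < Real.exp (-2 * Qhat) * C := by
    have hone : 1 < Real.exp (s * (1 - α) / a) :=
      Real.one_lt_exp_iff.mpr (div_pos (mul_pos hs (sub_pos.mpr hα1)) ha)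
    have hprod : Real.exp (-2 * Qhat) * C
        = Real.exp (s * (1 - α) / a) * ((s + a * M₀) / (s - a * M₀)) := by
      rw [hC, mul_div_assoc, ← mul_assoc, ← Real.exp_add, hQhat]
      congr 2
      field_simp
      ring
    rw [hprod]
    exact lt_mul_of_one_lt_left (div_pos hn hd) hone
  have hrat : 0 < (s + a * M₀) / (s - a * M₀) - 1 + 2 / (Qhat + 1) := by
    have heq : (s + a * M₀) / (s - a * M₀) - 1 + 2 / (Qhat + 1)
        = 2 * (a * M₀) * (s * M₀) / ((s - a * M₀) * (s * M₀ + (s - a * M₀))) := by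
      rw [hQ, div_neg, div_div_eq_mul_div]
      field_simp
      ring
    rw [heq]
    positivity
  have hQne : Qhat + 1 ≠ 0 := by
    intro h
    linarith
  have hF : Real.exp (-2 * Qhat) - 1 / C + 2 / (C * (Qhat + 1))
      = (Real.exp (-2 * Qhat) * C - 1 + 2 / (Qhat + 1)) / C := by
    field_simp
  rw [hF]
  exact div_pos (by linarith) hCpos
end

section
/- Let 0 < α < 1, M₀ > 0, and A, B > 0 satisfy (A + Bα)·M₀² = 2. Set C = exp((−√2(α+1) − 2√2/M₀)/√A) · (√2 + √A·M₀)/(√2 − √A·M₀) and Q̂ = −√2(1 + 1/M₀)/√A, and let Q₀ < 0 be the unique negative solution of C·exp(−2Q₀)·(Q₀ + 1) = Q₀ − 1. Then Q̂ < Q₀. (Hence the head slope λ₁(V₀) = √A·Q̂ of the first-family rarefaction wave lies strictly to the left of its tail slope η₀ = √A·Q₀, so the rarefaction fan connecting (1, −√2) to the piston state is well defined.) -/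
/-- Under the normalization `(A + Bα)M₀² = 2`, the head slope `Q̂` of the
first-family rarefaction wave lies strictly to the left of the tail slope `Q₀`,
where `Q₀ < 0` is the unique negative solution of
`C·exp(-2Q₀)(Q₀+1) = Q₀ - 1`. -/
theorem receding_head_lt_tail
    (α A B M₀ : ℝ) (hα0 : 0 < α) (hα1 : α < 1) (hA : 0 < A) (hB : 0 < B)
    (hM : 0 < M₀) (hnorm : (A + B * α) * M₀ ^ 2 = 2)
    (C : ℝ)
    (hC : C = Real.exp ((-Real.sqrt 2 * (α + 1) - 2 * Real.sqrt 2 / M₀) / Real.sqrt A)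
      * (Real.sqrt 2 + Real.sqrt A * M₀) / (Real.sqrt 2 - Real.sqrt A * M₀))
    (Qhat : ℝ) (hQhat : Qhat = -Real.sqrt 2 * (1 + 1 / M₀) / Real.sqrt A)
    (Q₀ : ℝ) (hQ₀neg : Q₀ < 0)
    (hQ₀ : C * Real.exp (-2 * Q₀) * (Q₀ + 1) = Q₀ - 1) :
    Qhat < Q₀ := by
  have hs : 0 < Real.sqrt 2 := by positivity
  have hs2 : Real.sqrt 2 ^ 2 = 2 := Real.sq_sqrt (by norm_num)
  have ha : 0 < Real.sqrt A := Real.sqrt_pos.2 hA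
  have ha2 : Real.sqrt A ^ 2 = A := Real.sq_sqrt hA.le
  set s := Real.sqrt 2
  set a := Real.sqrt A
  have hsub : a * M₀ < s := by
    refine lt_of_pow_lt_pow_left₀ 2 hs.le ?_
    have : 0 < B * α * M₀ ^ 2 := by positivity
    rw [mul_pow, ha2, hs2]
    linarith
  by_contra! hle
  have hQhat' : Qhat = -(s / a) - s / (a * M₀) := by
    rw [hQhat]; field_simp; ring
  have hsa : 0 < s / a := by positivity
  have hq : s / (a * M₀) < -Q₀ := by linarith
  have hq1 : 1 < s / (a * M₀) := (one_lt_div (by positivity)).2 hsub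
  have hqm : s < -Q₀ * (a * M₀) := (div_lt_iff₀ (by positivity)).1 hq
  set e := (-s * (α + 1) - 2 * s / M₀) / a
  have he : e = 2 * Qhat + s / a * (1 - α) := by
    simp only [e, hQhat']; field_simp; ring
  have hk : 1 ≤ Real.exp e * Real.exp (-2 * Q₀) := by
    rw [← Real.exp_add, Real.one_le_exp_iff, he]
    have : 0 < s / a * (1 - α) := mul_pos hsa (by linarith)
    linarith
  have hd : 0 < s - a * M₀ := by linarith
  have hEq : Real.exp e * Real.exp (-2 * Q₀) * ((s + a * M₀) * (-Q₀ - 1))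
      = (s - a * M₀) * (-Q₀ + 1) := by
    rw [hC] at hQ₀
    field_simp at hQ₀
    rw [← neg_mul] at hQ₀
    linear_combination -hQ₀
  have hpos : 0 < (s + a * M₀) * (-Q₀ - 1) :=
    mul_pos (by positivity) (by linarith)
  have hmono := le_mul_of_one_le_left hpos.le hk
  rw [hEq] at hmono
  linarith
end

section
/- Let 0 < α ≤ 1 and M₀ > 0. There exists ρ₁ > 1 satisfying α·M₀² = (1 − 1/ρ₁)(1 − 1/ρ₁^α) if and only if M₀ < √(1/α), and in that case such ρ₁ is unique. (Hence for the generalized Chaplygin gas a shock wave solution of the proceeding piston problem exists precisely for subcritical Mach numbers M₀ ∈ (0, √(α^{−1})), while for M₀ ≥ √(α^{−1}) no shock-wave piston solution exists.) -/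
open Filter Topology Set

/-- The function `ρ ↦ (1 - 1/ρ)(1 - 1/ρ^α)` is strictly increasing on `[1, ∞)`. -/
lemma strictMonoOn_one_sub_inv_mul_one_sub_inv_rpow {α : ℝ} (hα : 0 < α) :
    StrictMonoOn (fun x : ℝ => (1 - 1 / x) * (1 - 1 / x ^ α)) (Ici 1) := by
  intro x hx y _ hxy
  have hx1 : (1 : ℝ) ≤ x := hx
  have hx0 : 0 < x := by linarith
  have hxα : 1 ≤ x ^ α := Real.one_le_rpow hx1 hα.le
  have hpow : x ^ α < y ^ α := Real.rpow_lt_rpow hx0.le hxy hα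
  have h₁ : 1 / y < 1 / x := one_div_lt_one_div_of_lt hx0 hxy
  have h₂ : 1 / y ^ α < 1 / x ^ α := one_div_lt_one_div_of_lt (by linarith) hpow
  have h₃ : 1 / x ≤ 1 := (div_le_one hx0).2 hx1
  have h₄ : 1 / x ^ α ≤ 1 := (div_le_one (by linarith)).2 hxα
  exact mul_lt_mul'' (by linarith) (by linarith) (by linarith) (by linarith)

lemma tendsto_one_sub_inv_mul_one_sub_inv_rpow_atTop {α : ℝ} (hα : 0 < α) :
    Tendsto (fun x : ℝ => (1 - 1 / x) * (1 - 1 / x ^ α)) atTop (𝓝 1) := by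
  have h₁ : Tendsto (fun x : ℝ => x⁻¹) atTop (𝓝 0) := tendsto_inv_atTop_zero
  have h₂ : Tendsto (fun x : ℝ => (x ^ α)⁻¹) atTop (𝓝 0) :=
    tendsto_inv_atTop_zero.comp (tendsto_rpow_atTop hα)
  simpa using (h₁.const_sub 1).mul (h₂.const_sub 1)

lemma continuousOn_one_sub_inv_mul_one_sub_inv_rpow (α : ℝ) :
    ContinuousOn (fun x : ℝ => (1 - 1 / x) * (1 - 1 / x ^ α)) (Ioi 0) := by
  intro x hx
  have hx0 : (0 : ℝ) < x := hx
  have hpow : ContinuousAt (fun x : ℝ => x ^ α) x :=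
    Real.continuousAt_rpow_const x α (Or.inl hx0.ne')
  have hdiv := continuousAt_const (y := (1 : ℝ)).div hpow (Real.rpow_pos_of_pos hx0 α).ne'
  have hinv := continuousAt_const (y := (1 : ℝ)).div continuousAt_id hx0.ne'
  exact ((continuousAt_const.sub hinv).mul (continuousAt_const.sub hdiv)).continuousWithinAt

/-- The function `ρ ↦ (1 - 1/ρ)(1 - 1/ρ^α)` maps `(1, ∞)` onto `(0, 1)`. -/
lemma exists_eq_one_sub_inv_mul_one_sub_inv_rpow_iff {α c : ℝ} (hα : 0 < α) (hc : 0 < c) :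
    (∃ x : ℝ, 1 < x ∧ c = (1 - 1 / x) * (1 - 1 / x ^ α)) ↔ c < 1 := by
  constructor
  · rintro ⟨x, hx, rfl⟩
    have hx0 : 0 < x := by linarith
    have hxα : 1 < x ^ α := Real.one_lt_rpow hx hα
    have h₁ : 0 < 1 / x := by positivity
    have h₂ : 0 < 1 / x ^ α := by positivity
    have h₃ : 1 / x < 1 := (div_lt_one hx0).2 hx
    have h₄ : 1 / x ^ α < 1 := (div_lt_one (by linarith)).2 hxα
    nlinarith
  · intro hc1
    obtain ⟨R, hR, hR1⟩ :=
      (((tendsto_one_sub_inv_mul_one_sub_inv_rpow_atTop hα).eventually_const_lt hc1).and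
        (eventually_gt_atTop 1)).exists
    have hsub : Icc 1 R ⊆ Ioi (0 : ℝ) := fun y hy => lt_of_lt_of_le one_pos hy.1
    obtain ⟨x, hx, hxc⟩ := intermediate_value_Icc hR1.le
      ((continuousOn_one_sub_inv_mul_one_sub_inv_rpow α).mono hsub)
      (show c ∈ Icc _ _ from ⟨by simpa using hc.le, hR.le⟩)
    refine ⟨x, lt_of_le_of_ne hx.1 ?_, hxc.symm⟩
    rintro rfl
    simp at hxc
    exact hc.ne hxc

/-- For `0 < α ≤ 1` and `M₀ > 0`, a shock density `ρ₁ > 1` with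
`α·M₀² = (1 - 1/ρ₁)(1 - 1/ρ₁^α)` exists iff `M₀ < √(1/α)`, and in that case
it is unique. -/
theorem gcg_shock_exists_iff_subcritical
    (α M₀ : ℝ) (hα0 : 0 < α) (hα1 : α ≤ 1) (hM : 0 < M₀) :
    ((∃ ρ₁ : ℝ, 1 < ρ₁ ∧ α * M₀ ^ 2 = (1 - 1 / ρ₁) * (1 - 1 / ρ₁ ^ α)) ↔
      M₀ < Real.sqrt (1 / α)) ∧
    (∀ ρ₁ ρ₂ : ℝ, 1 < ρ₁ → α * M₀ ^ 2 = (1 - 1 / ρ₁) * (1 - 1 / ρ₁ ^ α) →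
      1 < ρ₂ → α * M₀ ^ 2 = (1 - 1 / ρ₂) * (1 - 1 / ρ₂ ^ α) → ρ₁ = ρ₂) := by
  refine ⟨?_, fun x y hx hfx hy hfy =>
    (strictMonoOn_one_sub_inv_mul_one_sub_inv_rpow hα0).injOn hx.le hy.le (hfx.symm.trans hfy)⟩
  rw [exists_eq_one_sub_inv_mul_one_sub_inv_rpow_iff hα0 (by positivity),
    Real.lt_sqrt hM.le, lt_div_iff₀ hα0, mul_comm]
end

section
/- For every continuously differentiable, compactly supported function φ : ℝ² → ℝ, the following identity holds: ∫_0^∞ ∫_{−∞}^0 ∂_t φ(t, x) dx dt + ∫_0^∞ √2·t·∂_t φ(t, 0) dt + √2·∫_0^∞ ∫_{−∞}^0 ∂_x φ(t, x) dx dt + ∫_{−∞}^0 φ(0, x) dx = 0. (This is the statement that the Radon measure τ = I_Ω·L² + √2·t·δ_{{x=0, t≥0}}, together with m = √2·I_Ω·L², satisfies the weak mass-conservation equation of the limiting piston problem with initial density ρ₀ = 1; in particular the boundary weight w_ρ(t) = √2·t encodes concentration of mass on the piston.) -/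
section Slices

variable {φ : ℝ × ℝ → ℝ}

theorem hasCompactSupport_slice_left (hφc : HasCompactSupport φ) (x : ℝ) :
    HasCompactSupport fun t => φ (t, x) :=
  hφc.comp_isClosedEmbedding
    (Function.LeftInverse.isClosedEmbedding (f := Prod.fst) (fun _ => rfl) continuous_fst
      (by fun_prop))

theorem hasCompactSupport_slice_right (hφc : HasCompactSupport φ) (t : ℝ) :
    HasCompactSupport fun x => φ (t, x) :=
  hφc.comp_isClosedEmbedding
    (Function.LeftInverse.isClosedEmbedding (f := Prod.snd) (fun _ => rfl) continuous_snd
      (by fun_prop))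

theorem contDiff_slice_left (hφ : ContDiff ℝ 1 φ) (x : ℝ) : ContDiff ℝ 1 fun t => φ (t, x) :=
  hφ.comp (contDiff_id.prodMk contDiff_const)

theorem contDiff_slice_right (hφ : ContDiff ℝ 1 φ) (t : ℝ) : ContDiff ℝ 1 fun x => φ (t, x) :=
  hφ.comp (contDiff_const.prodMk contDiff_id)

theorem hasDerivAt_slice_left (hφ : ContDiff ℝ 1 φ) (t x : ℝ) :
    HasDerivAt (fun s => φ (s, x)) (fderiv ℝ φ (t, x) (1, 0)) t :=
  (hφ.differentiable one_ne_zero (t, x)).hasFDerivAt.comp_hasDerivAt t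
    ((hasDerivAt_id t).prodMk (hasDerivAt_const t x))

theorem hasDerivAt_slice_right (hφ : ContDiff ℝ 1 φ) (t x : ℝ) :
    HasDerivAt (fun y => φ (t, y)) (fderiv ℝ φ (t, x) (0, 1)) x :=
  (hφ.differentiable one_ne_zero (t, x)).hasFDerivAt.comp_hasDerivAt x
    ((hasDerivAt_const x t).prodMk (hasDerivAt_id x))

theorem integral_Ioi_fderiv_slice_left (hφ : ContDiff ℝ 1 φ) (hφc : HasCompactSupport φ)
    (a x : ℝ) : ∫ t in Set.Ioi a, fderiv ℝ φ (t, x) (1, 0) = -φ (a, x) := by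
  simpa only [(hasDerivAt_slice_left hφ _ x).deriv] using
    (hasCompactSupport_slice_left hφc x).integral_Ioi_deriv_eq
      (contDiff_slice_left hφ x) a

theorem integral_Iio_fderiv_slice_right (hφ : ContDiff ℝ 1 φ) (hφc : HasCompactSupport φ)
    (t b : ℝ) : ∫ x in Set.Iio b, fderiv ℝ φ (t, x) (0, 1) = φ (t, b) := by
  rw [← MeasureTheory.integral_Iic_eq_integral_Iio]
  simpa only [(hasDerivAt_slice_right hφ t _).deriv] using
    (hasCompactSupport_slice_right hφc t).integral_Iic_deriv_eq
      (contDiff_slice_right hφ t) b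

theorem integrable_fderiv_apply (hφ : ContDiff ℝ 1 φ) (hφc : HasCompactSupport φ) (v : ℝ × ℝ) :
    MeasureTheory.Integrable fun p => fderiv ℝ φ p v :=
  ((hφ.continuous_fderiv one_ne_zero).clm_apply continuous_const).integrable_of_hasCompactSupport
    (hφc.fderiv_apply (𝕜 := ℝ) v)

theorem integral_Ioi_integral_Iio_fderiv_left (hφ : ContDiff ℝ 1 φ) (hφc : HasCompactSupport φ)
    (a b : ℝ) :
    ∫ t in Set.Ioi a, ∫ x in Set.Iio b, fderiv ℝ φ (t, x) (1, 0) =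
      -∫ x in Set.Iio b, φ (a, x) := by
  rw [MeasureTheory.integral_integral_swap]
  · simp only [integral_Ioi_fderiv_slice_left hφ hφc, MeasureTheory.integral_neg]
  · rw [MeasureTheory.Measure.prod_restrict]
    exact (integrable_fderiv_apply hφ hφc (1, 0)).integrableOn

end Slices

theorem integral_Ioi_zero_mul_deriv {f : ℝ → ℝ} (hf : ContDiff ℝ 1 f) (hfc : HasCompactSupport f) :
    ∫ t in Set.Ioi (0 : ℝ), t * deriv f t = -∫ t in Set.Ioi (0 : ℝ), f t := by
  have hderiv : deriv (fun t => t * f t) = fun t => f t + t * deriv f t := by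
    funext t
    simpa using ((hasDerivAt_id' t).fun_mul (hf.differentiable one_ne_zero t).hasDerivAt).deriv
  have h := (hfc.mul_left (f := fun t => t)).integral_Ioi_deriv_eq (contDiff_id.mul hf) 0
  have hint : MeasureTheory.Integrable fun t => t * deriv f t :=
    (continuous_id.mul (hf.continuous_deriv le_rfl)).integrable_of_hasCompactSupport
      hfc.deriv.mul_left
  change ∫ t in Set.Ioi (0 : ℝ), deriv (fun t => t * f t) t = -(0 * f 0) at h
  rw [hderiv, MeasureTheory.integral_add
    (hf.continuous.integrable_of_hasCompactSupport hfc).integrableOn hint.integrableOn] at h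
  linarith

/-- The Radon measure `τ = I_Ω·L² + √2·t·δ_{x=0,t≥0}` together with
`m = √2·I_Ω·L²` satisfies the weak mass-conservation equation of the limiting
piston problem with initial density `ρ₀ = 1`. -/
theorem radon_measure_mass_equation
    (φ : ℝ × ℝ → ℝ) (hφ : ContDiff ℝ 1 φ) (hφc : HasCompactSupport φ) :
    (∫ t in Set.Ioi (0:ℝ), ∫ x in Set.Iio (0:ℝ), fderiv ℝ φ (t, x) (1, 0))
      + (∫ t in Set.Ioi (0:ℝ), Real.sqrt 2 * t * fderiv ℝ φ (t, 0) (1, 0))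
      + Real.sqrt 2 *
        (∫ t in Set.Ioi (0:ℝ), ∫ x in Set.Iio (0:ℝ), fderiv ℝ φ (t, x) (0, 1))
      + (∫ x in Set.Iio (0:ℝ), φ (0, x)) = 0 := by
  have hboundary : ∫ t in Set.Ioi (0 : ℝ), t * fderiv ℝ φ (t, 0) (1, 0) =
      -∫ t in Set.Ioi (0 : ℝ), φ (t, 0) := by
    simpa only [(hasDerivAt_slice_left hφ _ 0).deriv] using
      integral_Ioi_zero_mul_deriv (contDiff_slice_left hφ 0)
        (hasCompactSupport_slice_left hφc 0)
  simp only [integral_Ioi_integral_Iio_fderiv_left hφ hφc,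
    integral_Iio_fderiv_slice_right hφ hφc, mul_assoc, MeasureTheory.integral_const_mul, hboundary]
  ring
end
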